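/- No planar graph on n vertices has more than 2^{1.53 n} simple cycles. -/

import Mathlib

noncomputable section

/-- The unit sphere `Σ` in `ℝ³`. -/
abbrev Sphere2 : Type := Metric.sphere (0 : EuclideanSpace ℝ (Fin 3)) 1

/-- `A` is a simple arc on the sphere from `x` to `y`. -/
def IsArc (A : Set Sphere2) (x y : Sphere2) : Prop :=
  ∃ f : ℝ → Sphere2, ContinuousOn f (Set.Icc 0 1) ∧ Set.InjOn f (Set.Icc 0 1) ∧
    f 0 = x ∧ f 1 = y ∧ f '' Set.Icc 0 1 = A

/-- A plane drawing (planar embedding) of a graph `G` in the sphere `Σ`: vertices are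
mapped to distinct points, edges to simple arcs between their end vertices, and arcs
do not cross, except in common end vertices. -/
structure SphereEmbedding {V : Type*} (G : SimpleGraph V) where
  pos : V → Sphere2
  arc : Sym2 V → Set Sphere2
  pos_inj : Function.Injective pos
  arc_isArc : ∀ e ∈ G.edgeSet, ∀ v w : V, e = s(v, w) → IsArc (arc e) (pos v) (pos w)
  arc_vertex : ∀ e ∈ G.edgeSet, ∀ v : V, pos v ∈ arc e → v ∈ e
  arc_inter : ∀ e ∈ G.edgeSet, ∀ e' ∈ G.edgeSet, e ≠ e' →
    arc e ∩ arc e' ⊆ {x | ∃ v : V, v ∈ e ∧ v ∈ e' ∧ pos v = x}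

/-- The point set of the drawing. -/
def SphereEmbedding.image {V : Type*} {G : SimpleGraph V} (D : SphereEmbedding G) :
    Set Sphere2 :=
  Set.range D.pos ∪ ⋃ e ∈ G.edgeSet, D.arc e

/-- A planar graph is a graph that admits a plane drawing. -/
def SimpleGraph.IsPlanar {V : Type*} (G : SimpleGraph V) : Prop :=
  Nonempty (SphereEmbedding G)

/-- A face of a plane drawing: a connected region of `Σ` minus the drawing. -/
def SphereEmbedding.IsFace {V : Type*} {G : SimpleGraph V} (D : SphereEmbedding G)
    (U : Set Sphere2) : Prop :=
  ∃ x ∈ D.imageᶜ, U = connectedComponentIn D.imageᶜ x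

/-- Two plane drawings of the same graph are equivalent (homeomorphic) if some
homeomorphism of the sphere maps vertices, edges (and hence faces) of the first
drawing onto vertices and edges of the second. -/
def SphereEmbedding.EquivEmb {V : Type*} {G : SimpleGraph V}
    (D₁ D₂ : SphereEmbedding G) : Prop :=
  ∃ (φ : Sphere2 ≃ₜ Sphere2) (σ : G ≃g G),
    (∀ v, φ (D₁.pos v) = D₂.pos (σ v)) ∧
    ∀ e ∈ G.edgeSet, φ '' D₁.arc e = D₂.arc (e.map σ)

/-- `G` is 3-connected: it has at least 4 vertices and deleting any at most two
vertices leaves it connected. -/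
def ThreeConnected {V : Type*} [Fintype V] (G : SimpleGraph V) : Prop :=
  4 ≤ Fintype.card V ∧
    ∀ s : Set V, s.ncard ≤ 2 → (((⊤ : G.Subgraph).deleteVerts s).coe).Connected

/-- `G` is maximal planar: planar, and no edge can be added keeping planarity. -/
def IsMaximalPlanar {V : Type*} (G : SimpleGraph V) : Prop :=
  G.IsPlanar ∧ ∀ H : SimpleGraph V, G ≤ H → H.IsPlanar → H = G

/-! ### Logarithms along curves and the non-planarity of `K₅` -/

/-- A continuous nowhere vanishing function on a simply connected space has a continuous
logarithm. -/
theorem exists_continuous_exp_eq {A : Type*} [TopologicalSpace A] [SimplyConnectedSpace A]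
    [LocallyPathConnectedSpace A] {f : A → ℂ} (hf : Continuous f) (h0 : ∀ a, f a ≠ 0) :
    ∃ F : A → ℂ, Continuous F ∧ ∀ a, Complex.exp (F a) = f a := by
  obtain ⟨a₀⟩ : Nonempty A := inferInstance
  obtain ⟨F, ⟨-, hF⟩, -⟩ := Complex.isCoveringMapOn_exp.existsUnique_continuousMap_lifts
    (⟨f, hf⟩ : C(A, ℂ)) (a₀ := a₀) (e₀ := Complex.log (f a₀)) (Complex.exp_log (h0 a₀))
    (fun a => h0 a)
  exact ⟨F, F.continuous, fun a => congrFun hF a⟩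

/-- Logarithms of proportional curves have the same increments. -/
theorem sub_eq_sub_of_exp_eq_mul {F G : ℝ → ℂ} (hF : Continuous F) (hG : Continuous G) (c : ℂ)
    (h : ∀ t, Complex.exp (F t) = c * Complex.exp (G t)) (s t : ℝ) :
    F t - F s = G t - G s := by
  have hc : ∀ t, Complex.exp (F t - G t) = c := fun t => by
    rw [Complex.exp_sub, h, mul_div_assoc, div_self (Complex.exp_ne_zero _), mul_one]
  have := Complex.isCoveringMap_exp.const_of_comp (g := fun t => F t - G t) (hF.sub hG)
    (fun a a' => Subtype.ext ((hc a).trans (hc a').symm)) t s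
  linear_combination this

/-- The difference of two plane curves with disjoint images has a continuous logarithm on the
parameter plane. -/
theorem exists_continuous_log_sub {f g : ℝ → ℂ} (hf : Continuous f) (hg : Continuous g)
    (hfg : ∀ s t, f s ≠ g t) :
    ∃ L : ℝ × ℝ → ℂ, Continuous L ∧ ∀ x, Complex.exp (L x) = f x.1 - g x.2 :=
  exists_continuous_exp_eq (by fun_prop) fun x => sub_ne_zero.2 (hfg x.1 x.2)

/-- The parity argument behind the non-planarity of `K₅`: the relations between the winding
integers of the curves have no solution, because `K₅` has five pairs of crossing diagonals. -/
theorem false_of_square_relations (k : Fin 5 → Fin 5 → Fin 5 → ℤ)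
    (h : ∀ a b c d : Fin 5, a < b → c < d → a ≠ c → a ≠ d → b ≠ c → b ≠ d →
      (if b < c then -1 else 1) - (if a < c then -1 else 1) + (if d < b then -1 else 1)
        - (if d < a then -1 else 1) + 2 * (k c a b + k b c d - k a c d - k d a b) = 0) :
    False := by
  have sq : ∀ a b c d : Fin 5, ∀ m : ℤ, a < b → c < d → a ≠ c → a ≠ d → b ≠ c → b ≠ d →
      ((if b < c then -1 else 1) - (if a < c then -1 else 1) + (if d < b then -1 else 1)
        - (if d < a then -1 else 1) : ℤ) = 2 * m →
      m + (k c a b + k b c d - k a c d - k d a b) = 0 := by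
    intro a b c d m h₁ h₂ h₃ h₄ h₅ h₆ hm
    have := h a b c d h₁ h₂ h₃ h₄ h₅ h₆
    omega
  have e1 := sq 0 1 2 3 (0) (by decide) (by decide) (by decide) (by decide) (by decide)
    (by decide) (by decide)
  have e2 := sq 0 2 1 3 (1) (by decide) (by decide) (by decide) (by decide) (by decide)
    (by decide) (by decide)
  have e3 := sq 0 3 1 2 (0) (by decide) (by decide) (by decide) (by decide) (by decide)
    (by decide) (by decide)
  have e4 := sq 0 1 2 4 (0) (by decide) (by decide) (by decide) (by decide) (by decide)
    (by decide) (by decide)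
  have e5 := sq 0 2 1 4 (1) (by decide) (by decide) (by decide) (by decide) (by decide)
    (by decide) (by decide)
  have e6 := sq 0 4 1 2 (0) (by decide) (by decide) (by decide) (by decide) (by decide)
    (by decide) (by decide)
  have e7 := sq 0 1 3 4 (0) (by decide) (by decide) (by decide) (by decide) (by decide)
    (by decide) (by decide)
  have e8 := sq 0 3 1 4 (1) (by decide) (by decide) (by decide) (by decide) (by decide)
    (by decide) (by decide)
  have e9 := sq 0 4 1 3 (0) (by decide) (by decide) (by decide) (by decide) (by decide)
    (by decide) (by decide)
  have e10 := sq 0 2 3 4 (0) (by decide) (by decide) (by decide) (by decide) (by decide)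
    (by decide) (by decide)
  have e11 := sq 0 3 2 4 (1) (by decide) (by decide) (by decide) (by decide) (by decide)
    (by decide) (by decide)
  have e12 := sq 0 4 2 3 (0) (by decide) (by decide) (by decide) (by decide) (by decide)
    (by decide) (by decide)
  have e13 := sq 1 2 3 4 (0) (by decide) (by decide) (by decide) (by decide) (by decide)
    (by decide) (by decide)
  have e14 := sq 1 3 2 4 (1) (by decide) (by decide) (by decide) (by decide) (by decide)
    (by decide) (by decide)
  have e15 := sq 1 4 2 3 (0) (by decide) (by decide) (by decide) (by decide) (by decide)
    (by decide) (by decide)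
  clear sq h
  omega

open Complex in
/-- There are no five points of the plane joined pairwise by curves such that curves between
disjoint pairs of points are disjoint and no curve meets a third point. -/
theorem not_complete_five_curves (p : Fin 5 → ℂ) (γ : Fin 5 → Fin 5 → ℝ → ℂ)
    (hp : Function.Injective p) (hc : ∀ i j, Continuous (γ i j))
    (h0 : ∀ i j, i < j → γ i j 0 = p i) (h1 : ∀ i j, i < j → γ i j 1 = p j)
    (hv : ∀ i j k, i < j → k ≠ i → k ≠ j → ∀ t, γ i j t ≠ p k)
    (he : ∀ i j k l, i < j → k < l → i ≠ k → i ≠ l → j ≠ k → j ≠ l →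
      ∀ s t, γ i j s ≠ γ k l t) : False := by
  -- logarithms of the differences of the points, antisymmetric up to `π * I`
  obtain ⟨α, hα, hαs⟩ : ∃ α : Fin 5 → Fin 5 → ℂ, (∀ i j, i ≠ j → exp (α i j) = p i - p j) ∧
      ∀ i j, i < j → α j i = α i j + Real.pi * I := by
    refine ⟨fun i j => if i < j then log (p i - p j) else log (p j - p i) + Real.pi * I, ?_, ?_⟩
    · intro i j hij
      have hne : ∀ i j, i ≠ j → p i - p j ≠ 0 := fun i j h => sub_ne_zero.2 (hp.ne h)
      dsimp only
      split_ifs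
      · exact exp_log (hne i j hij)
      · rw [exp_add, exp_log (hne j i hij.symm), exp_pi_mul_I]; ring
    · intro i j hij
      simp [hij, hij.not_gt]
  have key : ∀ c a b, ∃ k : ℤ, a < b → c ≠ a → c ≠ b → ∀ F : ℝ → ℂ, Continuous F → ∀ z : ℂ,
      (∀ t, exp (F t) = z * (γ a b t - p c)) →
      F 1 - F 0 = α b c - α a c + k * (2 * Real.pi * I) := by
    intro c a b
    by_cases h : a < b ∧ c ≠ a ∧ c ≠ b
    · obtain ⟨hab, hca, hcb⟩ := h
      obtain ⟨G, hG, hGe⟩ := exists_continuous_exp_eq (f := fun t => γ a b t - p c)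
        ((hc a b).sub continuous_const) fun t => sub_ne_zero.2 (hv a b c hab hca hcb t)
      have e1 : exp (G 1 - G 0) = exp (α b c - α a c) := by
        rw [exp_sub, exp_sub, hGe, hGe, hα b c hcb.symm, hα a c hca.symm, h0 a b hab, h1 a b hab]
      obtain ⟨k, hk⟩ := exp_eq_exp_iff_exists_int.1 e1
      refine ⟨k, fun _ _ _ F hF z hz => ?_⟩
      rw [← hk]
      exact sub_eq_sub_of_exp_eq_mul hF hG z (fun t => by rw [hz, hGe]) 0 1
    · exact ⟨0, fun h₁ h₂ h₃ => absurd ⟨h₁, h₂, h₃⟩ h⟩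
  choose k hk using key
  have sq : ∀ a b c d, a < b → c < d → a ≠ c → a ≠ d → b ≠ c → b ≠ d →
      (α b c - α c b) - (α a c - α c a) + (α d b - α b d) - (α d a - α a d) +
        ((k c a b + k b c d - k a c d - k d a b : ℤ) : ℂ) * (2 * Real.pi * I) = 0 := by
    intro a b c d hab hcd hac had hbc hbd
    obtain ⟨L, hL, hLe⟩ :=
      exists_continuous_log_sub (hc a b) (hc c d) (he a b c d hab hcd hac had hbc hbd)
    have e1 := hk c a b hab hac.symm hbc.symm (fun t => L (t, 0)) (by fun_prop) 1
      (fun t => by rw [hLe, h0 c d hcd, one_mul])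
    have e2 := hk d a b hab had.symm hbd.symm (fun t => L (t, 1)) (by fun_prop) 1
      (fun t => by rw [hLe, h1 c d hcd, one_mul])
    have e3 := hk a c d hcd hac had (fun t => L (0, t)) (by fun_prop) (-1)
      (fun t => by rw [hLe, h0 a b hab]; ring)
    have e4 := hk b c d hcd hbc hbd (fun t => L (1, t)) (by fun_prop) (-1)
      (fun t => by rw [hLe, h1 a b hab]; ring)
    push_cast
    linear_combination e2 + e3 - e1 - e4
  -- `r i j` is `±1` according to the order of `i` and `j`
  obtain ⟨r, hr⟩ : ∃ r : Fin 5 → Fin 5 → ℤ, r = fun i j => if i < j then -1 else 1 := ⟨_, rfl⟩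
  have hαr : ∀ i j, i ≠ j → α i j - α j i = r i j * (Real.pi * I) := by
    intro i j hij
    rcases lt_or_gt_of_ne hij with h | h
    · rw [hαs i j h]; simp [hr, h]
    · rw [hαs j i h]; simp [hr, h.not_gt]
  have sqZ : ∀ a b c d, a < b → c < d → a ≠ c → a ≠ d → b ≠ c → b ≠ d →
      r b c - r a c + r d b - r d a + 2 * (k c a b + k b c d - k a c d - k d a b) = 0 := by
    intro a b c d hab hcd hac had hbc hbd
    have := sq a b c d hab hcd hac had hbc hbd
    rw [hαr b c hbc, hαr a c hac, hαr d b hbd.symm, hαr d a had.symm] at this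
    have hpi : (Real.pi * I : ℂ) ≠ 0 := mul_ne_zero (by exact_mod_cast Real.pi_ne_zero) I_ne_zero
    have h2 : ((r b c - r a c + r d b - r d a + 2 * (k c a b + k b c d - k a c d - k d a b) : ℤ) : ℂ)
        * (Real.pi * I) = 0 := by
      rw [← this]; push_cast; ring
    exact_mod_cast (mul_eq_zero.1 h2).resolve_right hpi
  exact false_of_square_relations k fun a b c d hab hcd hac had hbc hbd => by
    simpa only [hr] using sqZ a b c d hab hcd hac had hbc hbd

/-! ### Plane models of minors and the edge bound -/

/-- A plane model of the graph `H` with vertices in `S`: vertices are pairwise disjoint nonempty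
plane sets, edges are path-connected sets containing their end vertices, avoiding the other
vertices, and edges without a common end are disjoint. Such models persist in minors. -/
structure PlaneModel {V : Type*} (S : Finset V) (H : SimpleGraph V) where
  vert : V → Set ℂ
  edge : V → V → Set ℂ
  mem_of_adj : ∀ a b, H.Adj a b → a ∈ S
  vert_nonempty : ∀ a ∈ S, (vert a).Nonempty
  vert_disjoint : ∀ a ∈ S, ∀ b ∈ S, a ≠ b → Disjoint (vert a) (vert b)
  edge_pathConnected : ∀ a b, H.Adj a b → IsPathConnected (edge a b)
  left_subset : ∀ a b, H.Adj a b → vert a ⊆ edge a b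
  right_subset : ∀ a b, H.Adj a b → vert b ⊆ edge a b
  edge_vert_disjoint : ∀ a b, H.Adj a b → ∀ c ∈ S, c ≠ a → c ≠ b → Disjoint (edge a b) (vert c)
  edge_disjoint : ∀ a b c d, H.Adj a b → H.Adj c d → a ≠ c → a ≠ d → b ≠ c → b ≠ d →
    Disjoint (edge a b) (edge c d)

namespace PlaneModel

variable {V : Type*} {S : Finset V} {H : SimpleGraph V}

/-- A plane model restricts to subgraphs. -/
def mono (M : PlaneModel S H) {T : Finset V} {H' : SimpleGraph V} (hT : T ⊆ S) (hH : H' ≤ H)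
    (hmem : ∀ a b, H'.Adj a b → a ∈ T) : PlaneModel T H' where
  vert := M.vert
  edge := M.edge
  mem_of_adj := hmem
  vert_nonempty a ha := M.vert_nonempty a (hT ha)
  vert_disjoint a ha b hb := M.vert_disjoint a (hT ha) b (hT hb)
  edge_pathConnected a b h := M.edge_pathConnected a b (hH h)
  left_subset a b h := M.left_subset a b (hH h)
  right_subset a b h := M.right_subset a b (hH h)
  edge_vert_disjoint a b h c hc := M.edge_vert_disjoint a b (hH h) c (hT hc)
  edge_disjoint a b c d h h' := M.edge_disjoint a b c d (hH h) (hH h')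

/-- A graph with a plane model contains no `K₅`. -/
theorem not_isNClique_five (M : PlaneModel S H) (s : Finset V) (hs : H.IsNClique 5 s) : False := by
  let φ : Fin 5 ≃ s := (s.equivFinOfCardEq hs.card_eq).symm
  have hadj : ∀ i j, i ≠ j → H.Adj (φ i) (φ j) := fun i j hij =>
    hs.isClique (φ i).2 (φ j).2 fun h => hij (φ.injective (Subtype.ext h))
  have hne : ∀ i j, i ≠ j → (φ i : V) ≠ φ j := fun i j h => (hadj i j h).ne
  have hS : ∀ i, (φ i : V) ∈ S := fun i =>
    M.mem_of_adj _ (φ (i + 1)) (hadj i (i + 1) (by revert i; decide))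
  choose p hp using fun i => M.vert_nonempty (φ i) (hS i)
  have hpath : ∀ i j, ∃ g : ℝ → ℂ, Continuous g ∧
      (i < j → g 0 = p i ∧ g 1 = p j ∧ ∀ t, g t ∈ M.edge (φ i) (φ j)) := by
    intro i j
    by_cases hij : i < j
    · have ha := hadj i j hij.ne
      obtain ⟨γ, hγ⟩ := (M.edge_pathConnected _ _ ha).joinedIn (p i) (M.left_subset _ _ ha (hp i))
        (p j) (M.right_subset _ _ ha (hp j))
      refine ⟨γ.extend, γ.continuous_extend, fun _ => ⟨by simp, by simp, fun t => ?_⟩⟩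
      exact hγ _
    · exact ⟨fun _ => 0, continuous_const, fun h => absurd h hij⟩
  choose γ hγc hγ using hpath
  refine not_complete_five_curves p γ ?_ hγc (fun i j h => (hγ i j h).1)
    (fun i j h => (hγ i j h).2.1) ?_ ?_
  · intro i j hij
    by_contra h
    exact Set.disjoint_left.1 (M.vert_disjoint _ (hS i) _ (hS j) (hne i j h)) (hp i) (hij ▸ hp j)
  · intro i j k hij hki hkj t heq
    exact Set.disjoint_left.1 (M.edge_vert_disjoint _ _ (hadj i j hij.ne) _ (hS k) (hne k i hki)
      (hne k j hkj)) ((hγ i j hij).2.2 t) (heq ▸ hp k)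
  · intro i j k l hij hkl h1 h2 h3 h4 s t heq
    exact Set.disjoint_left.1 (M.edge_disjoint _ _ _ _ (hadj i j hij.ne) (hadj k l hkl.ne)
      (hne _ _ h1) (hne _ _ h2) (hne _ _ h3) (hne _ _ h4)) ((hγ i j hij).2.2 s)
      (heq ▸ (hγ k l hkl).2.2 t)

end PlaneModel

/-- The graph obtained from `H` by contracting the edge `xy` to the vertex `x`; the vertex `y`
becomes isolated. -/
def contractEdge {V : Type*} (H : SimpleGraph V) (x y : V) : SimpleGraph V where
  Adj a b := a ≠ b ∧ a ≠ y ∧ b ≠ y ∧ (H.Adj a b ∨ (a = x ∧ H.Adj y b) ∨ (b = x ∧ H.Adj y a))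
  symm := ⟨by
    rintro a b ⟨h1, h2, h3, h4⟩
    exact ⟨h1.symm, h3, h2, h4.imp (·.symm) Or.symm⟩⟩
  loopless := ⟨fun a h => h.1 rfl⟩

open Classical in
/-- Plane models persist under contraction of an edge. -/
def PlaneModel.contract {V : Type*} {S : Finset V} {H : SimpleGraph V}
    (M : PlaneModel S H) {x y : V} (hxy : H.Adj x y) :
    PlaneModel (S.erase y) (contractEdge H x y) := by
  have hxS : x ∈ S := M.mem_of_adj x y hxy
  have hyS : y ∈ S := M.mem_of_adj y x hxy.symm
  let star : V → Set ℂ := fun z =>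
    M.edge x y ∪ if H.Adj x z then M.edge x z else M.edge y z
  have star_conn : ∀ z, H.Adj x z ∨ H.Adj y z → IsPathConnected (star z) := by
    intro z hz
    dsimp only [star]
    split_ifs with h
    · exact (M.edge_pathConnected x y hxy).union (M.edge_pathConnected x z h)
        ((M.vert_nonempty x hxS).mono (Set.subset_inter (M.left_subset x y hxy)
          (M.left_subset x z h)))
    · have h' := hz.resolve_left h
      exact (M.edge_pathConnected x y hxy).union (M.edge_pathConnected y z h')
        ((M.vert_nonempty y hyS).mono (Set.subset_inter (M.right_subset x y hxy)
          (M.left_subset y z h')))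
  have star_vert : ∀ z, H.Adj x z ∨ H.Adj y z → M.vert z ⊆ star z := by
    intro z hz
    dsimp only [star]
    split_ifs with h
    · exact (M.right_subset x z h).trans Set.subset_union_right
    · exact (M.right_subset y z (hz.resolve_left h)).trans Set.subset_union_right
  have star_disj_vert : ∀ z, H.Adj x z ∨ H.Adj y z → ∀ c ∈ S, c ≠ x → c ≠ y → c ≠ z →
      Disjoint (star z) (M.vert c) := by
    intro z hz c hc hcx hcy hcz
    refine Disjoint.union_left (M.edge_vert_disjoint x y hxy c hc hcx hcy) ?_
    split_ifs with h
    · exact M.edge_vert_disjoint x z h c hc hcx hcz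
    · exact M.edge_vert_disjoint y z (hz.resolve_left h) c hc hcy hcz
  have star_disj_edge : ∀ z, H.Adj x z ∨ H.Adj y z → ∀ c d, H.Adj c d → c ≠ x → c ≠ y → c ≠ z →
      d ≠ x → d ≠ y → d ≠ z → Disjoint (star z) (M.edge c d) := by
    intro z hz c d hcd hcx hcy hcz hdx hdy hdz
    refine Disjoint.union_left (M.edge_disjoint x y c d hxy hcd hcx.symm hdx.symm hcy.symm
      hdy.symm) ?_
    split_ifs with h
    · exact M.edge_disjoint x z c d h hcd hcx.symm hdx.symm hcz.symm hdz.symm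
    · exact M.edge_disjoint y z c d (hz.resolve_left h) hcd hcy.symm hdy.symm hcz.symm hdz.symm
  have adj_left : ∀ b, (contractEdge H x y).Adj x b → H.Adj x b ∨ H.Adj y b := by
    rintro b ⟨h1, -, -, h | h | h⟩
    exacts [.inl h, .inr h.2, absurd h.1.symm h1]
  have adj_ne : ∀ a b, (contractEdge H x y).Adj a b → a ≠ x → b ≠ x → H.Adj a b := by
    rintro a b ⟨-, -, -, h | h | h⟩ ha hb
    exacts [h, absurd h.1 ha, absurd h.1 hb]
  refine
    { vert := fun a => if a = x then M.edge x y else M.vert a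
      edge := fun a b => if a = x then star b else if b = x then star a else M.edge a b
      mem_of_adj := ?_
      vert_nonempty := ?_
      vert_disjoint := ?_
      edge_pathConnected := ?_
      left_subset := ?_
      right_subset := ?_
      edge_vert_disjoint := ?_
      edge_disjoint := ?_ }
  · rintro a b ⟨h1, h2, h3, h | h | h⟩
    · exact Finset.mem_erase.2 ⟨h2, M.mem_of_adj a b h⟩
    · exact Finset.mem_erase.2 ⟨h2, h.1 ▸ hxS⟩
    · exact Finset.mem_erase.2 ⟨h2, M.mem_of_adj a y h.2.symm⟩
  · intro a ha
    split_ifs with h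
    · exact (M.edge_pathConnected x y hxy).nonempty
    · exact M.vert_nonempty a (Finset.mem_of_mem_erase ha)
  · intro a ha b hb hab
    obtain ⟨hay, haS⟩ := Finset.mem_erase.1 ha
    obtain ⟨hby, hbS⟩ := Finset.mem_erase.1 hb
    split_ifs with h h'
    · exact absurd (h.trans h'.symm) hab
    · exact M.edge_vert_disjoint x y hxy b hbS h' hby
    · exact (M.edge_vert_disjoint x y hxy a haS h hay).symm
    · exact M.vert_disjoint a haS b hbS hab
  · intro a b hab
    split_ifs with h h'
    · exact star_conn b (adj_left b (h ▸ hab))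
    · exact star_conn a (adj_left a (h' ▸ hab.symm))
    · exact M.edge_pathConnected a b (adj_ne a b hab h h')
  · intro a b hab
    split_ifs with h h'
    · exact Set.subset_union_left
    · exact star_vert a (adj_left a (h' ▸ hab.symm))
    · exact M.left_subset a b (adj_ne a b hab h h')
  · intro a b hab
    by_cases h : a = x
    · have hb : b ≠ x := fun hb => hab.1 (h.trans hb.symm)
      simpa only [h, hb, if_true, if_false] using star_vert b (adj_left b (h ▸ hab))
    · by_cases h' : b = x
      · simp only [h, h', if_true, if_false]
        exact Set.subset_union_left
      · simpa only [h, h', if_false] using M.right_subset a b (adj_ne a b hab h h')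
  · intro a b hab c hc hca hcb
    obtain ⟨hcy, hcS⟩ := Finset.mem_erase.1 hc
    have hay : a ≠ y := hab.2.1
    have hby : b ≠ y := hab.2.2.1
    by_cases h : a = x
    · have hcx : c ≠ x := h ▸ hca
      simp only [h, hcx, if_true, if_false]
      exact star_disj_vert b (adj_left b (h ▸ hab)) c hcS hcx hcy hcb
    · by_cases h' : b = x
      · have hcx : c ≠ x := h' ▸ hcb
        simp only [h, h', hcx, if_true, if_false]
        exact star_disj_vert a (adj_left a (h' ▸ hab.symm)) c hcS hcx hcy hca
      · have had := adj_ne a b hab h h'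
        by_cases hcx : c = x
        · simp only [h, h', hcx, if_true, if_false]
          exact M.edge_disjoint a b x y had hxy h hay h' hby
        · simp only [h, h', hcx, if_false]
          exact M.edge_vert_disjoint a b had c hcS hca hcb
  · intro a b c d hab hcd hac had hbc hbd
    have hay : a ≠ y := hab.2.1
    have hby : b ≠ y := hab.2.2.1
    have hcy : c ≠ y := hcd.2.1
    have hdy : d ≠ y := hcd.2.2.1
    by_cases ha : a = x
    · have hc : c ≠ x := fun h => hac (ha.trans h.symm)
      have hd : d ≠ x := fun h => had (ha.trans h.symm)
      simp only [ha, hc, hd, if_true, if_false]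
      exact star_disj_edge b (adj_left b (ha ▸ hab)) c d (adj_ne c d hcd hc hd) hc hcy hbc.symm hd
        hdy hbd.symm
    by_cases hb : b = x
    · have hc : c ≠ x := fun h => hbc (hb.trans h.symm)
      have hd : d ≠ x := fun h => hbd (hb.trans h.symm)
      simp only [ha, hb, hc, hd, if_true, if_false]
      exact star_disj_edge a (adj_left a (hb ▸ hab.symm)) c d (adj_ne c d hcd hc hd) hc hcy hac.symm
        hd hdy had.symm
    have hadj := adj_ne a b hab ha hb
    by_cases hc : c = x
    · simp only [ha, hb, hc, if_true, if_false]
      exact (star_disj_edge d (adj_left d (hc ▸ hcd)) a b hadj ha hay had hb hby hbd).symm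
    by_cases hd : d = x
    · simp only [ha, hb, hc, hd, if_true, if_false]
      exact (star_disj_edge c (adj_left c (hd ▸ hcd.symm)) a b hadj ha hay hac hb hby hbc).symm
    simp only [ha, hb, hc, hd, if_false]
    exact M.edge_disjoint a b c d hadj (adj_ne c d hcd hc hd) hac had hbc hbd

open Classical in
/-- Contracting the edge `xy` loses at most one edge plus one edge for every common neighbour. -/
theorem card_edgeFinset_le_contractEdge {V : Type*} [Fintype V] (H : SimpleGraph V) {x y : V}
    (hxy : H.Adj x y) :
    H.edgeFinset.card ≤ (contractEdge H x y).edgeFinset.card + 1 +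
      (H.neighborFinset y ∩ H.neighborFinset x).card := by
  have hx : x ∈ H.neighborFinset y := by simpa using hxy.symm
  have hsub : (H.deleteIncidenceSet y).edgeFinset ∪
      (((H.neighborFinset y).erase x) \ H.neighborFinset x).image (fun z => s(x, z)) ⊆
      (contractEdge H x y).edgeFinset := by
    intro e he
    induction e using Sym2.inductionOn with | hf a b => ?_
    rw [Finset.mem_union] at he
    rw [SimpleGraph.mem_edgeFinset, SimpleGraph.mem_edgeSet]
    rcases he with he | he
    · rw [SimpleGraph.mem_edgeFinset, SimpleGraph.mem_edgeSet,
        SimpleGraph.deleteIncidenceSet_adj] at he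
      exact ⟨he.1.ne, he.2.1, he.2.2, .inl he.1⟩
    · simp only [Finset.mem_image, Finset.mem_sdiff, Finset.mem_erase,
        SimpleGraph.mem_neighborFinset] at he
      obtain ⟨z, ⟨⟨hzx, hyz⟩, -⟩, hz⟩ := he
      have : (contractEdge H x y).Adj x z :=
        ⟨hzx.symm, hxy.ne, hyz.ne.symm, .inr (.inl ⟨rfl, hyz⟩)⟩
      rwa [← SimpleGraph.mem_edgeSet, ← hz, SimpleGraph.mem_edgeSet]
  have hdisj : Disjoint (H.deleteIncidenceSet y).edgeFinset
      ((((H.neighborFinset y).erase x) \ H.neighborFinset x).image (fun z => s(x, z))) := by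
    rw [Finset.disjoint_left]
    intro e he he'
    simp only [Finset.mem_image, Finset.mem_sdiff, Finset.mem_erase,
      SimpleGraph.mem_neighborFinset] at he'
    obtain ⟨z, ⟨-, hz⟩, rfl⟩ := he'
    rw [SimpleGraph.mem_edgeFinset, SimpleGraph.mem_edgeSet,
      SimpleGraph.deleteIncidenceSet_adj] at he
    exact hz he.1
  have hcard := Finset.card_le_card hsub
  rw [Finset.card_union_of_disjoint hdisj, Finset.card_image_of_injective _ (by
    intro z z' h; exact Sym2.congr_right.1 h), SimpleGraph.card_edgeFinset_deleteIncidenceSet] at hcard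
  have h1 : (((H.neighborFinset y).erase x) \ H.neighborFinset x).card +
      (H.neighborFinset y ∩ H.neighborFinset x).card = H.degree y - 1 := by
    rw [← SimpleGraph.card_neighborFinset_eq_degree, ← Finset.card_erase_of_mem hx,
      ← Finset.card_sdiff_add_card_inter ((H.neighborFinset y).erase x) (H.neighborFinset x)]
    congr 2
    ext z
    simp only [Finset.mem_inter, Finset.mem_erase, SimpleGraph.mem_neighborFinset]
    exact ⟨fun h => ⟨⟨h.2.ne.symm, h.1⟩, h.2⟩, fun h => ⟨h.1.2, h.2⟩⟩
  have h2 : 1 ≤ H.degree y := by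
    rw [← SimpleGraph.card_neighborFinset_eq_degree]
    exact Finset.card_pos.2 ⟨x, hx⟩
  omega

open Classical in
/-- A graph with fewer than `3 |S|` edges has a vertex of degree at most five in `S`. -/
theorem exists_degree_le_five {V : Type*} [Fintype V] {H : SimpleGraph V} {S : Finset V}
    (hcard : H.edgeFinset.card < 3 * S.card) : ∃ v ∈ S, H.degree v ≤ 5 := by
  by_contra! h
  have h1 : S.card * 6 ≤ ∑ v ∈ S, H.degree v := by
    rw [← smul_eq_mul]
    exact Finset.card_nsmul_le_sum S _ 6 fun v hv => h v hv
  have h2 : ∑ v ∈ S, H.degree v ≤ ∑ v, H.degree v :=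
    Finset.sum_le_sum_of_subset (Finset.subset_univ S)
  rw [SimpleGraph.sum_degrees_eq_twice_card_edges] at h2
  omega

open Classical in
/-- If every neighbour of a vertex `v` of degree four or five has at least three common neighbours
with `v`, then there is a `K₅`-minor, which contradicts the existence of a plane model. -/
theorem PlaneModel.false_of_three_le_card_inter {V : Type*} [Fintype V] {S : Finset V}
    {H : SimpleGraph V} (M : PlaneModel S H) {v : V} (h4 : 4 ≤ H.degree v) (h5 : H.degree v ≤ 5)
    (h : ∀ x, H.Adj v x → 3 ≤ (H.neighborFinset v ∩ H.neighborFinset x).card) : False := by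
  have hcard : (H.neighborFinset v).card = H.degree v := H.card_neighborFinset_eq_degree v
  have hsat : ∀ x, H.Adj v x → ∀ T : Finset V, H.neighborFinset v ∩ H.neighborFinset x ⊆ T →
      T.card ≤ 3 → ∀ z ∈ T, H.Adj x z := by
    intro x hx T hT hT3 z hz
    rw [← Finset.eq_of_subset_of_card_le hT (hT3.trans (h x hx))] at hz
    simpa using (Finset.mem_inter.1 hz).2
  have hinter : ∀ x, H.neighborFinset v ∩ H.neighborFinset x ⊆ (H.neighborFinset v).erase x := by
    intro x z hz
    rw [Finset.mem_inter] at hz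
    exact Finset.mem_erase.2 ⟨((H.mem_neighborFinset x z).1 hz.2).ne.symm, hz.1⟩
  have hinter2 : ∀ x y, ¬ H.Adj x y → H.neighborFinset v ∩ H.neighborFinset x ⊆
      ((H.neighborFinset v).erase x).erase y := by
    intro x y hxy z hz
    refine Finset.mem_erase.2 ⟨?_, hinter x hz⟩
    rintro rfl
    exact hxy ((H.mem_neighborFinset x z).1 (Finset.mem_inter.1 hz).2)
  rcases Nat.lt_or_ge (H.degree v) 5 with hlt | hge
  · have hclique : H.IsNClique 4 (H.neighborFinset v) := by
      refine ⟨fun x hx y hy hxy => ?_, by omega⟩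
      have hx' : x ∈ H.neighborFinset v := hx
      refine hsat x ((H.mem_neighborFinset v x).1 hx') _ (hinter x) ?_ y
        (Finset.mem_erase.2 ⟨hxy.symm, hy⟩)
      rw [Finset.card_erase_of_mem hx']
      omega
    exact M.not_isNClique_five _ (hclique.insert fun b hb => (H.mem_neighborFinset v b).1 hb)
  by_cases hall : H.IsClique (H.neighborFinset v : Set V)
  · exact M.not_isNClique_five _ ⟨hall, by omega⟩
  simp only [SimpleGraph.IsClique, Set.Pairwise, not_forall] at hall
  obtain ⟨a, ha, b, hb, hab, hnadj⟩ := hall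
  simp only [SimpleGraph.coe_neighborFinset, SimpleGraph.mem_neighborSet] at ha hb
  have hrest : (((H.neighborFinset v).erase a).erase b).card = 3 := by
    rw [Finset.card_erase_of_mem (Finset.mem_erase.2 ⟨hab.symm, by simpa using hb⟩),
      Finset.card_erase_of_mem (by simpa using ha)]
    omega
  have hadja : ∀ z, H.Adj v z → z ≠ a → z ≠ b → H.Adj a z := fun z hz hza hzb =>
    hsat a ha _ (hinter2 a b hnadj) hrest.le z (by simp [hz, hza, hzb])
  have hadjb : ∀ z, H.Adj v z → z ≠ a → z ≠ b → H.Adj b z := fun z hz hza hzb =>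
    hsat b hb _ (hinter2 b a fun hba => hnadj hba.symm)
      (by rw [Finset.erase_right_comm]; exact hrest.le) z (by simp [hz, hza, hzb])
  have key : ∀ c d e, H.Adj v c → H.Adj v d → H.Adj v e → c ≠ a → c ≠ b → d ≠ a → d ≠ b →
      e ≠ a → e ≠ b → c ≠ d → c ≠ e → H.Adj d e → False := by
    intro c d e hc hd he hca hcb hda hdb hea heb hcd hce hde
    have hac := hadja c hc hca hcb
    have hkeep : ∀ y z, H.Adj y z → y ≠ c → z ≠ c → (contractEdge H a c).Adj y z :=
      fun y z hyz hy hz => ⟨hyz.ne, hy, hz, .inl hyz⟩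
    have hab' : (contractEdge H a c).Adj a b :=
      ⟨hab, hca.symm, hcb.symm, .inr (.inl ⟨rfl, (hadjb c hc hca hcb).symm⟩)⟩
    refine (M.contract hac).not_isNClique_five {v, a, b, d, e} ?_
    have h3 : (contractEdge H a c).IsNClique 3 {b, d, e} :=
      SimpleGraph.is3Clique_triple_iff.2 ⟨hkeep b d (hadjb d hd hda hdb) hcb.symm hcd.symm,
        hkeep b e (hadjb e he hea heb) hcb.symm hce.symm, hkeep d e hde hcd.symm hce.symm⟩
    refine (h3.insert (a := a) ?_).insert (a := v) ?_
    · simp only [Finset.mem_insert, Finset.mem_singleton]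
      rintro z (rfl | rfl | rfl)
      exacts [hab', hkeep _ _ (hadja _ hd hda hdb) hca.symm hcd.symm,
        hkeep _ _ (hadja _ he hea heb) hca.symm hce.symm]
    · simp only [Finset.mem_insert, Finset.mem_singleton]
      rintro z (rfl | rfl | rfl | rfl)
      exacts [hkeep _ _ ha hc.ne hca.symm, hkeep _ _ hb hc.ne hcb.symm,
        hkeep _ _ hd hc.ne hcd.symm, hkeep _ _ he hc.ne hce.symm]
  obtain ⟨c, d, e, hcd, hce, hde, hR⟩ := Finset.card_eq_three.1 hrest
  have hmem : ∀ z ∈ ({c, d, e} : Finset V), H.Adj v z ∧ z ≠ a ∧ z ≠ b := by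
    intro z hz
    rw [← hR] at hz
    simp only [Finset.mem_erase, SimpleGraph.mem_neighborFinset] at hz
    exact ⟨hz.2.2, hz.2.1, hz.1⟩
  obtain ⟨hc, hca, hcb⟩ := hmem c (by simp)
  obtain ⟨hd, hda, hdb⟩ := hmem d (by simp)
  obtain ⟨he, hea, heb⟩ := hmem e (by simp)
  by_cases hadj : H.Adj d e
  · exact key c d e hc hd he hca hcb hda hdb hea heb hcd hce hadj
  · have hec : H.Adj e c := by
      refine hsat e he _ (hinter2 e d fun h' => hadj h'.symm) ?_ c (by simp [hcd, hce, hc])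
      rw [Finset.card_erase_of_mem (Finset.mem_erase.2 ⟨hde, by simpa using hd⟩),
        Finset.card_erase_of_mem (by simpa using he)]
      omega
    exact key d e c hd he hc hda hdb hea heb hca hcb hde hcd.symm hec

open Classical in
/-- A graph with a plane model on `n ≥ 3` vertices has at most `3 n - 6` edges. -/
theorem PlaneModel.card_edgeFinset_add_six_le {V : Type*} [Fintype V] {S : Finset V}
    {H : SimpleGraph V} (M : PlaneModel S H) (hS : 3 ≤ S.card) :
    H.edgeFinset.card + 6 ≤ 3 * S.card := by
  obtain ⟨k, hn⟩ : ∃ k, S.card = k := ⟨_, rfl⟩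
  rw [hn] at hS ⊢
  induction k, hS using Nat.le_induction generalizing S H with
  | base =>
    have hdeg : ∀ v ∈ Finset.univ, H.degree v ≤ if v ∈ S then 2 else 0 := by
      intro v _
      split_ifs with hv
      · rw [← SimpleGraph.card_neighborFinset_eq_degree]
        have : H.neighborFinset v ⊆ S.erase v := fun z hz => by
          have hz' := (H.mem_neighborFinset v z).1 hz
          exact Finset.mem_erase.2 ⟨hz'.ne.symm, M.mem_of_adj z v hz'.symm⟩
        have := Finset.card_le_card this
        rw [Finset.card_erase_of_mem hv] at this
        omega
      · rw [← SimpleGraph.card_neighborFinset_eq_degree, Nat.le_zero, Finset.card_eq_zero,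
          Finset.eq_empty_iff_forall_notMem]
        intro z hz
        exact hv (M.mem_of_adj v z ((H.mem_neighborFinset v z).1 hz))
    have h1 := Finset.sum_le_sum hdeg
    rw [SimpleGraph.sum_degrees_eq_twice_card_edges, Finset.sum_ite_mem, Finset.univ_inter,
      Finset.sum_const, hn, smul_eq_mul] at h1
    omega
  | succ n hn3 ih =>
    by_contra! hlt
    obtain ⟨H', hle, hTcard⟩ : ∃ H' ≤ H, H'.edgeFinset.card = 3 * n - 2 := by
      obtain ⟨T, hT, hTcard⟩ := Finset.exists_subset_card_eq
        (s := H.edgeFinset) (n := 3 * n - 2) (by omega)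
      refine ⟨SimpleGraph.fromEdgeSet T, fun a b hab => ?_, ?_⟩
      · simpa using hT (((SimpleGraph.fromEdgeSet_adj _).1 hab).1)
      · have hT' : ∀ _ : Fintype (SimpleGraph.fromEdgeSet (T : Set (Sym2 V))).edgeSet,
            (SimpleGraph.fromEdgeSet (T : Set (Sym2 V))).edgeFinset = T := by
          intro _
          ext e
          rw [SimpleGraph.mem_edgeFinset, SimpleGraph.edgeSet_fromEdgeSet]
          exact ⟨fun h => h.1, fun h => ⟨h, H.not_isDiag_of_mem_edgeFinset (hT h)⟩⟩
        exact (congrArg Finset.card (hT' _)).trans hTcard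
    have M' : PlaneModel S H' := M.mono subset_rfl hle fun a b h => M.mem_of_adj a b (hle h)
    obtain ⟨v, hv, hv5⟩ := exists_degree_le_five (H := H') (S := S) (by omega)
    have herase : (S.erase v).card = n := by rw [Finset.card_erase_of_mem hv]; omega
    rcases Nat.lt_or_ge (H'.degree v) 4 with h4 | h4
    · have := ih (M'.mono (Finset.erase_subset v S) (H'.deleteIncidenceSet_le v) fun a b h => by
        rw [SimpleGraph.deleteIncidenceSet_adj] at h
        exact Finset.mem_erase.2 ⟨h.2.1, M'.mem_of_adj a b h.1⟩) herase
      have h1 : (H'.deleteIncidenceSet v).edgeFinset.card + 6 ≤ 3 * n := by convert this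
      rw [SimpleGraph.card_edgeFinset_deleteIncidenceSet] at h1
      omega
    · refine M'.false_of_three_le_card_inter h4 hv5 fun x hx => ?_
      have h1 := card_edgeFinset_le_contractEdge H' hx.symm
      have h2 := ih (M'.contract hx.symm) herase
      omega

/-! ### Projecting a spherical drawing to the plane -/

instance sphere2FinrankFact : Fact (Module.finrank ℝ (EuclideanSpace ℝ (Fin 3)) = 2 + 1) :=
  ⟨by simp⟩

/-- Stereographic projection onto the complex plane. -/
theorem exists_plane_chart (p : Sphere2) : ∃ φ : OpenPartialHomeomorph Sphere2 ℂ,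
    φ.source = {p}ᶜ ∧ φ.target = Set.univ :=
  ⟨(stereographic' 2 p).trans
    Complex.orthonormalBasisOneI.repr.symm.toHomeomorph.toOpenPartialHomeomorph, by simp, by simp⟩

/-- The sphere remains connected after the removal of two points. -/
theorem isPreconnected_sphere2_compl_pair {p q : Sphere2} (hpq : p ≠ q) :
    IsPreconnected ({p, q}ᶜ : Set Sphere2) := by
  obtain ⟨φ, hs, ht⟩ := exists_plane_chart p
  have hq : q ∈ φ.source := by simpa [hs] using hpq.symm
  have himage : ({p, q}ᶜ : Set Sphere2) = φ.symm '' {φ q}ᶜ := by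
    ext x
    constructor
    · intro hx
      simp only [Set.mem_compl_iff, Set.mem_insert_iff, Set.mem_singleton_iff, not_or] at hx
      have hx' : x ∈ φ.source := by simpa [hs] using hx.1
      exact ⟨φ x, fun h => hx.2 (φ.injOn hx' hq h), φ.left_inv hx'⟩
    · rintro ⟨z, hz, rfl⟩
      have hz' : z ∈ φ.target := by simp [ht]
      have h1 := φ.map_target hz'
      rw [hs] at h1
      simp only [Set.mem_compl_iff, Set.mem_insert_iff, Set.mem_singleton_iff, not_or]
      refine ⟨h1, fun h => hz ?_⟩
      rw [Set.mem_singleton_iff, ← h, φ.right_inv hz']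
  rw [himage]
  refine (isConnected_compl_singleton_of_one_lt_rank (by simp) (φ q)).isPreconnected.image _ ?_
  exact φ.continuousOn_symm.mono (by simp [ht])

/-- A simple arc on the sphere has empty interior. -/
theorem IsArc.interior_eq_empty {A : Set Sphere2} {x y : Sphere2} (hA : IsArc A x y) :
    interior A = ∅ := by
  obtain ⟨f, hc, hinj, -, -, rfl⟩ := hA
  by_contra hne
  rw [← ne_eq, ← Set.nonempty_iff_ne_empty] at hne
  set U := interior (f '' Set.Icc 0 1) with hU
  let F : unitInterval → Sphere2 := fun t => f t
  have hF : Continuous F := continuousOn_iff_continuous_domRestrict.1 hc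
  have hFinj : Function.Injective F := fun s t h => Subtype.ext (hinj s.2 t.2 h)
  have hUF : ∀ z ∈ U, ∃ t, F t = z := by
    intro z hz
    obtain ⟨t, ht, rfl⟩ := interior_subset hz
    exact ⟨⟨t, ht⟩, rfl⟩
  obtain ⟨a, b, hab, hsub⟩ := ((isOpen_interior (s := f '' Set.Icc 0 1)).preimage hF).exists_Ioo_subset
    (by obtain ⟨z, hz⟩ := hne; obtain ⟨t, rfl⟩ := hUF z hz; exact ⟨t, hz⟩)
  obtain ⟨s, has, hsb⟩ := exists_between hab
  obtain ⟨t, hst, htb⟩ := exists_between hsb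
  obtain ⟨r, hsr, hrt⟩ := exists_between hst
  have hclosed : ∀ K : Set unitInterval, IsClosed K → IsClosed (F '' K) := fun K hK =>
    (hK.isCompact.image hF).isClosed
  have hmem : ∀ (K : Set unitInterval) (i : unitInterval), F i ∈ F '' K ↔ i ∈ K := fun K i =>
    hFinj.mem_set_image
  have hopen : IsOpen (F '' Set.Ioo s t) := by
    have : F '' Set.Ioo s t = U ∩ (F '' (Set.Iic s ∪ Set.Ici t))ᶜ := by
      ext z
      constructor
      · rintro ⟨i, hi, rfl⟩
        refine ⟨hsub ⟨has.trans hi.1, hi.2.trans htb⟩, ?_⟩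
        rw [Set.mem_compl_iff, hmem]
        rintro (h | h)
        exacts [not_le.2 hi.1 h, not_le.2 hi.2 h]
      · rintro ⟨hz, hz'⟩
        obtain ⟨i, rfl⟩ := hUF z hz
        rw [Set.mem_compl_iff, hmem] at hz'
        simp only [Set.mem_union, Set.mem_Iic, Set.mem_Ici, not_or, not_le] at hz'
        exact ⟨i, hz', rfl⟩
    rw [this]
    exact isOpen_interior.inter (hclosed _ (isClosed_Iic.union isClosed_Ici)).isOpen_compl
  have hconn := isPreconnected_sphere2_compl_pair (hFinj.ne hst.ne)
  have hne' : ∀ i, i ≠ s → i ≠ t → F i ∈ ({F s, F t}ᶜ : Set Sphere2) := by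
    intro i his hit
    simp only [Set.mem_compl_iff, Set.mem_insert_iff, Set.mem_singleton_iff, not_or]
    exact ⟨hFinj.ne his, hFinj.ne hit⟩
  obtain ⟨z, hz, hz1, hz2⟩ := hconn (F '' Set.Ioo s t) (F '' Set.Icc s t)ᶜ hopen
    (hclosed _ isClosed_Icc).isOpen_compl (by
      intro z hz
      by_cases hz' : z ∈ F '' Set.Icc s t
      · obtain ⟨i, hi, rfl⟩ := hz'
        simp only [Set.mem_compl_iff, Set.mem_insert_iff, Set.mem_singleton_iff, not_or,
          hFinj.eq_iff] at hz
        exact .inl ⟨i, ⟨lt_of_le_of_ne hi.1 (Ne.symm hz.1), lt_of_le_of_ne hi.2 hz.2⟩, rfl⟩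
      · exact .inr hz')
    ⟨F r, hne' r hsr.ne' hrt.ne, r, ⟨hsr, hrt⟩, rfl⟩
    ⟨F a, hne' a has.ne (has.trans hst).ne, by
      rw [Set.mem_compl_iff, hmem]
      exact fun h => not_le.2 has h.1⟩
  exact hz2 (Set.image_mono Set.Ioo_subset_Icc_self hz1)

/-- A plane drawing of a finite graph does not cover the sphere. -/
theorem SphereEmbedding.exists_notMem_image {V : Type*} [Finite V] {G : SimpleGraph V}
    (D : SphereEmbedding G) : ∃ p, p ∉ D.image := by
  by_contra! h
  have hrank : 1 < Module.rank ℝ (EuclideanSpace ℝ (Fin 3)) := by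
    rw [← Module.finrank_eq_rank]; simp
  have : ConnectedSpace Sphere2 :=
    Subtype.connectedSpace (isConnected_sphere hrank 0 zero_le_one)
  have : Nontrivial Sphere2 := by
    obtain ⟨p⟩ := (inferInstance : Nonempty Sphere2)
    exact ⟨p, -p, ne_neg_of_mem_unit_sphere ℝ p⟩
  have harc : ∀ e : G.edgeSet, ∃ x y, IsArc (D.arc e) x y := by
    rintro ⟨e, he⟩
    induction e using Sym2.inductionOn with | hf a b => ?_
    exact ⟨_, _, D.arc_isArc _ he a b rfl⟩
  obtain ⟨i, hi⟩ := nonempty_interior_of_iUnion_of_closed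
    (f := Sum.elim (fun v : V => {D.pos v}) (fun e : G.edgeSet => D.arc e)) (by
      rintro (v | e)
      · exact isClosed_singleton
      · obtain ⟨x, y, f, hf, -, -, -, hA⟩ := harc e
        rw [Sum.elim_inr, ← hA]
        exact (isCompact_Icc.image_of_continuousOn hf).isClosed) (by
      rw [Set.eq_univ_iff_forall]
      intro z
      rw [Set.mem_iUnion]
      rcases h z with ⟨v, rfl⟩ | hz
      · exact ⟨.inl v, rfl⟩
      · simp only [Set.mem_iUnion] at hz
        obtain ⟨e, he, hz⟩ := hz
        exact ⟨.inr ⟨e, he⟩, hz⟩)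
  rcases i with v | e
  · simp at hi
  · obtain ⟨x, y, hA⟩ := harc e
    simp [hA.interior_eq_empty] at hi

/-- A planar graph has a plane model. -/
theorem SimpleGraph.IsPlanar.nonempty_planeModel {V : Type*} [Fintype V] {G : SimpleGraph V}
    (hG : G.IsPlanar) : Nonempty (PlaneModel Finset.univ G) := by
  obtain ⟨D⟩ := hG
  obtain ⟨p, hp⟩ := D.exists_notMem_image
  obtain ⟨φ, hs, -⟩ := exists_plane_chart p
  have himage : ∀ z ∈ D.image, z ∈ φ.source := by
    intro z hz
    rw [hs]
    rintro rfl
    exact hp hz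
  have hpos : ∀ v, D.pos v ∈ φ.source := fun v => himage _ (.inl ⟨v, rfl⟩)
  have harc : ∀ a b, G.Adj a b → D.arc s(a, b) ⊆ φ.source := fun a b hab z hz =>
    himage z (.inr (Set.mem_biUnion (show s(a, b) ∈ G.edgeSet from hab) hz))
  have hleft : ∀ a b, G.Adj a b → D.pos a ∈ D.arc s(a, b) := by
    intro a b hab
    obtain ⟨f, -, -, h0, -, hA⟩ := D.arc_isArc s(a, b) hab a b rfl
    rw [← hA, ← h0]
    exact ⟨0, by simp, rfl⟩
  refine ⟨{ vert := fun a => {φ (D.pos a)}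
            edge := fun a b => φ '' D.arc s(a, b)
            mem_of_adj := fun a b _ => Finset.mem_univ a
            vert_nonempty := fun a _ => Set.singleton_nonempty _
            vert_disjoint := ?_
            edge_pathConnected := ?_
            left_subset := ?_
            right_subset := ?_
            edge_vert_disjoint := ?_
            edge_disjoint := ?_ }⟩
  · intro a _ b _ hab
    rw [Set.disjoint_singleton]
    exact fun h => hab (D.pos_inj (φ.injOn (hpos a) (hpos b) h))
  · intro a b hab
    obtain ⟨f, hf, -, -, -, hA⟩ := D.arc_isArc s(a, b) hab a b rfl
    have h1 : IsPathConnected (D.arc s(a, b)) := by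
      rw [← hA]
      exact ((convex_Icc (0 : ℝ) 1).isPathConnected ⟨0, by simp⟩).image' hf
    exact h1.image' (φ.continuousOn.mono (harc a b hab))
  · rintro a b hab _ rfl
    exact ⟨_, hleft a b hab, rfl⟩
  · rintro a b hab _ rfl
    exact ⟨_, Sym2.eq_swap ▸ hleft b a hab.symm, rfl⟩
  · intro a b hab c _ hca hcb
    rw [Set.disjoint_singleton_right]
    rintro ⟨z, hz, hzc⟩
    rw [φ.injOn (harc a b hab hz) (hpos c) hzc] at hz
    rcases Sym2.mem_iff.1 (D.arc_vertex s(a, b) hab c hz) with h | h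
    exacts [hca h, hcb h]
  · intro a b c d hab hcd hac had hbc hbd
    rw [Set.disjoint_left]
    rintro _ ⟨z, hz, rfl⟩ ⟨z', hz', hzz⟩
    rw [φ.injOn (harc c d hcd hz') (harc a b hab hz) hzz] at hz'
    have hne : s(a, b) ≠ s(c, d) := by
      intro h
      rcases Sym2.eq_iff.1 h with h | h
      exacts [hac h.1, had h.1]
    obtain ⟨v, hv, hv', -⟩ := D.arc_inter _ hab _ hcd hne ⟨hz, hz'⟩
    rcases Sym2.mem_iff.1 hv with rfl | rfl <;> rcases Sym2.mem_iff.1 hv' with h | h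
    exacts [hac h, had h, hbc h, hbd h]

/-! ### Counting paths and cycles by their edge sets -/

section Counting

open Classical

variable {V : Type*}

/-- The degree of a vertex. -/
def vdeg (H : SimpleGraph V) (u : V) : ℕ := (H.neighborSet u).ncard

theorem vdeg_deleteIncidenceSet_of_not_adj {H : SimpleGraph V} {s u : V} (hne : u ≠ s)
    (h : ¬ H.Adj s u) : vdeg (H.deleteIncidenceSet s) u = vdeg H u := by
  rw [vdeg, vdeg]
  congr 1
  ext x
  rw [SimpleGraph.mem_neighborSet, SimpleGraph.mem_neighborSet,
    SimpleGraph.deleteIncidenceSet_adj]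
  exact ⟨fun hx => hx.1, fun hx => ⟨hx, hne, fun hxs => h (hxs ▸ hx.symm)⟩⟩

theorem vdeg_deleteIncidenceSet_of_adj {H : SimpleGraph V} {s u : V} (h : H.Adj s u) :
    vdeg (H.deleteIncidenceSet s) u = vdeg H u - 1 := by
  rw [vdeg, vdeg, ← Set.ncard_sdiff_singleton_of_mem (show s ∈ H.neighborSet u from h.symm)]
  congr 1
  ext x
  rw [Set.mem_sdiff, SimpleGraph.mem_neighborSet, SimpleGraph.mem_neighborSet,
    SimpleGraph.deleteIncidenceSet_adj]
  exact ⟨fun hx => ⟨hx.1, hx.2.2⟩, fun hx => ⟨hx.1, h.ne.symm, hx.2⟩⟩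

theorem vdeg_deleteEdges_left {H : SimpleGraph V} {v a : V} (h : H.Adj v a) :
    vdeg (H.deleteEdges {s(v, a)}) v = vdeg H v - 1 := by
  rw [vdeg, vdeg, ← Set.ncard_sdiff_singleton_of_mem (show a ∈ H.neighborSet v from h)]
  congr 1
  ext x
  simp only [SimpleGraph.mem_neighborSet, SimpleGraph.deleteEdges_adj, Set.mem_singleton_iff,
    Set.mem_sdiff, Sym2.congr_right]

variable [Fintype V]

/-- The edge sets of the paths of `H` from `s` to `t`. -/
def pathSets (H : SimpleGraph V) (s t : V) : Finset (Finset (Sym2 V)) :=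
  Finset.univ.filter fun F => ∃ p : H.Walk s t, p.IsPath ∧ p.edges.toFinset = F

/-- The edge sets of the cycles of `H`. -/
def cycleSets (H : SimpleGraph V) : Finset (Finset (Sym2 V)) :=
  Finset.univ.filter fun F => ∃ (v : V) (w : H.Walk v v), w.IsCycle ∧ w.edges.toFinset = F

theorem mem_pathSets {H : SimpleGraph V} {s t : V} {F : Finset (Sym2 V)} :
    F ∈ pathSets H s t ↔ ∃ p : H.Walk s t, p.IsPath ∧ p.edges.toFinset = F := by
  simp [pathSets]

theorem mem_cycleSets {H : SimpleGraph V} {F : Finset (Sym2 V)} :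
    F ∈ cycleSets H ↔ ∃ (v : V) (w : H.Walk v v), w.IsCycle ∧ w.edges.toFinset = F := by
  simp [cycleSets]

theorem vdeg_eq_degree (H : SimpleGraph V) (u : V) : vdeg H u = H.degree u := by
  rw [vdeg, Set.ncard_eq_toFinset_card', ← SimpleGraph.card_neighborFinset_eq_degree,
    SimpleGraph.neighborFinset]

theorem vdeg_mono {H H' : SimpleGraph V} (h : H ≤ H') (u : V) : vdeg H u ≤ vdeg H' u :=
  Set.ncard_le_ncard fun _ hx => h hx

theorem vdeg_pos {H : SimpleGraph V} {s a : V} (h : H.Adj s a) : 0 < vdeg H a :=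
  (Set.ncard_pos (Set.toFinite _)).2 ⟨s, h.symm⟩

theorem vdeg_deleteIncidenceSet_self (H : SimpleGraph V) (s : V) :
    vdeg (H.deleteIncidenceSet s) s = 0 := by
  rw [vdeg, Set.ncard_eq_zero, Set.eq_empty_iff_forall_notMem]
  intro x hx
  exact (SimpleGraph.deleteIncidenceSet_adj.1 hx).2.1 rfl

/-- Splitting off the first edge of a path. -/
theorem pathSets_subset_biUnion {H : SimpleGraph V} {s t : V} (hst : s ≠ t) :
    pathSets H s t ⊆ (H.neighborFinset s).biUnion fun a =>
      (pathSets (H.deleteIncidenceSet s) a t).image (insert s(s, a)) := by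
  intro F hF
  obtain ⟨p, hp, rfl⟩ := mem_pathSets.1 hF
  cases p with
  | nil => exact absurd rfl hst
  | @cons _ a _ h p =>
    rw [SimpleGraph.Walk.cons_isPath_iff] at hp
    rw [Finset.mem_biUnion]
    refine ⟨a, by simpa using h, Finset.mem_image.2 ⟨p.edges.toFinset, mem_pathSets.2 ?_, ?_⟩⟩
    · have hedges : ∀ e ∈ p.edges, e ∈ (H.deleteIncidenceSet s).edgeSet := by
        intro e he
        rw [SimpleGraph.edgeSet_deleteIncidenceSet]
        refine ⟨p.edges_subset_edgeSet he, fun hinc => hp.2 ?_⟩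
        induction e using Sym2.inductionOn with | hf x y => ?_
        rcases Sym2.mem_iff.1 hinc.2 with rfl | rfl
        exacts [p.fst_mem_support_of_mem_edges he, p.snd_mem_support_of_mem_edges he]
      exact ⟨p.transfer _ hedges, hp.1.transfer hedges, by rw [SimpleGraph.Walk.edges_transfer]⟩
    · rw [SimpleGraph.Walk.edges_cons, List.toFinset_cons]

theorem card_pathSets_self_le (H : SimpleGraph V) (t : V) : (pathSets H t t).card ≤ 1 := by
  refine Finset.card_le_one.2 fun F hF F' hF' => ?_
  obtain ⟨p, hp, rfl⟩ := mem_pathSets.1 hF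
  obtain ⟨q, hq, rfl⟩ := mem_pathSets.1 hF'
  rw [(SimpleGraph.Walk.isPath_iff_nil.1 hp).eq_nil, (SimpleGraph.Walk.isPath_iff_nil.1 hq).eq_nil]

/-- A cycle through the edge `va` consists of this edge and a path from `a` to `v`. -/
theorem cycleSets_subset_union {H : SimpleGraph V} {v a : V} :
    cycleSets H ⊆ cycleSets (H.deleteEdges {s(v, a)}) ∪
      (pathSets (H.deleteEdges {s(v, a)}) a v).image (insert s(v, a)) := by
  have key : ∀ c : H.Walk v v, c.IsCycle → c.snd = a → c.edges.toFinset ∈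
      (pathSets (H.deleteEdges {s(v, a)}) a v).image (insert s(v, a)) := by
    intro c hc hsnd
    cases c with
    | nil => exact absurd hc SimpleGraph.Walk.not_isCycle_nil
    | cons h p =>
      rw [SimpleGraph.Walk.snd_cons] at hsnd
      subst hsnd
      rw [SimpleGraph.Walk.cons_isCycle_iff] at hc
      have hp : ∀ e ∈ p.edges, e ∉ ({s(v, _)} : Set (Sym2 V)) := fun e he hev => hc.2 (hev ▸ he)
      refine Finset.mem_image.2 ⟨p.edges.toFinset, mem_pathSets.2 ⟨p.toDeleteEdges _ hp, ?_, ?_⟩, ?_⟩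
      · exact SimpleGraph.Walk.IsPath.toDeleteEdges _ _ hc.1 hp
      · simp [SimpleGraph.Walk.toDeleteEdges]
      · rw [SimpleGraph.Walk.edges_cons, List.toFinset_cons]
  intro F hF
  obtain ⟨x, w, hw, rfl⟩ := mem_cycleSets.1 hF
  rw [Finset.mem_union]
  by_cases he : s(v, a) ∈ w.edges
  · right
    have hv : v ∈ w.support := w.fst_mem_support_of_mem_edges he
    have hperm := (w.rotate_edges v hv).perm
    have hfin : w.edges.toFinset = (w.rotate v hv).edges.toFinset := by
      ext e
      rw [List.mem_toFinset, List.mem_toFinset, hperm.mem_iff]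
    rw [← hperm.mem_iff] at he
    rw [hfin]
    have hc : (w.rotate v hv).IsCycle := hw.rotate hv
    generalize w.rotate v hv = c at hc he
    by_cases hsnd : c.snd = a
    · exact key c hc hsnd
    · have hrev := key c.reverse hc.reverse (by
        rw [SimpleGraph.Walk.snd_reverse]
        cases c with
        | nil => exact absurd hc SimpleGraph.Walk.not_isCycle_nil
        | cons h p =>
          have hnil := SimpleGraph.Walk.not_nil_of_isCycle_cons hc
          rw [SimpleGraph.Walk.snd_cons] at hsnd
          rw [SimpleGraph.Walk.penultimate_cons_of_not_nil h p hnil]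
          rw [SimpleGraph.Walk.edges_cons, List.mem_cons] at he
          rw [SimpleGraph.Walk.cons_isCycle_iff] at hc
          rcases he with he | he
          · exact absurd (Sym2.congr_right.1 he).symm hsnd
          · exact (hc.1.eq_penultimate_of_mem_edges he).symm)
      rwa [SimpleGraph.Walk.edges_reverse, List.toFinset_reverse] at hrev
  · left
    have hw' : ∀ e ∈ w.edges, e ∉ ({s(v, a)} : Set (Sym2 V)) := fun e h hev => he (hev ▸ h)
    exact mem_cycleSets.2 ⟨x, w.toDeleteEdges _ hw', SimpleGraph.Walk.IsCycle.toDeleteEdges _ _ hw hw', by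
      simp [SimpleGraph.Walk.toDeleteEdges]⟩

end Counting

/-! ### Degree weights -/

/-- The weight of an inner vertex of degree `k` in the bound on the number of paths. -/
def vertexWeight : ℕ → ℝ
  | 0 => 1
  | 1 => 1
  | 2 => 1.23
  | 3 => 1.58
  | 4 => 1.96
  | 5 => 2.42
  | k + 6 => 2.86 * 1.17 ^ k

/-- The weight of a start vertex of degree `k` in the bound on the number of paths. -/
def startWeight : ℕ → ℝ
  | 0 => 0
  | 1 => 1
  | 2 => 1.58
  | 3 => 1.91
  | _ + 4 => 2.32

theorem vertexWeight_le_succ (k : ℕ) : vertexWeight k ≤ vertexWeight (k + 1) := by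
  match k with
  | 0 | 1 | 2 | 3 | 4 | 5 => norm_num [vertexWeight]
  | k + 6 =>
    change (2.86 : ℝ) * 1.17 ^ k ≤ 2.86 * 1.17 ^ (k + 1)
    gcongr <;> norm_num

theorem vertexWeight_monotone : Monotone vertexWeight :=
  monotone_nat_of_le_succ vertexWeight_le_succ

theorem one_le_vertexWeight (k : ℕ) : 1 ≤ vertexWeight k :=
  vertexWeight_monotone (Nat.zero_le k)

theorem vertexWeight_pos (k : ℕ) : 0 < vertexWeight k :=
  zero_lt_one.trans_le (one_le_vertexWeight k)

theorem startWeight_le_succ (k : ℕ) : startWeight k ≤ startWeight (k + 1) := by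
  match k with
  | 0 | 1 | 2 | 3 => norm_num [startWeight]
  | k + 4 => exact le_rfl

theorem startWeight_monotone : Monotone startWeight :=
  monotone_nat_of_le_succ startWeight_le_succ

theorem startWeight_nonneg (k : ℕ) : 0 ≤ startWeight k :=
  startWeight_monotone (Nat.zero_le k)

theorem one_le_startWeight {k : ℕ} (hk : 0 < k) : 1 ≤ startWeight k :=
  startWeight_monotone hk

theorem startWeight_le_vertexWeight_succ (k : ℕ) : startWeight k ≤ vertexWeight (k + 1) := by
  match k with
  | 0 | 1 | 2 | 3 | 4 => norm_num [startWeight, vertexWeight]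
  | k + 5 =>
    refine le_trans ?_ (vertexWeight_monotone (show 6 ≤ k + 5 + 1 by omega))
    norm_num [startWeight, vertexWeight]

theorem vertexWeight_mul_le (k : ℕ) : vertexWeight k * 1.17 ^ 6 ≤ 2.86 * 1.17 ^ k := by
  match k with
  | 0 | 1 | 2 | 3 | 4 | 5 => norm_num [vertexWeight]
  | k + 6 => rw [vertexWeight, mul_assoc, ← pow_add]

theorem choose_two_le_vertexWeight {k : ℕ} (hk : k ≤ 5) :
    (k : ℝ) * (k - 1) / 2 ≤ 10 / 2.42 * vertexWeight k := by
  interval_cases k <;> norm_num [vertexWeight]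

/-- The weight ratios of consecutive degrees lie below a line `α - β u`, as soon as this holds for
degrees up to seven. -/
theorem weight_ratio_le_of_le_six {α β : ℝ} (hβ : 0 ≤ β)
    (h : ∀ k ≤ 6, vertexWeight k / vertexWeight (k + 1) ≤
      α - β * (startWeight k / vertexWeight k)) (k : ℕ) :
    vertexWeight k / vertexWeight (k + 1) ≤ α - β * (startWeight k / vertexWeight k) := by
  rcases le_total k 6 with hk | hk
  · exact h k hk
  obtain ⟨i, rfl⟩ := Nat.exists_eq_add_of_le' hk
  have h1 : vertexWeight (i + 6) / vertexWeight (i + 6 + 1) =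
      vertexWeight 6 / vertexWeight (6 + 1) := by
    change (2.86 * 1.17 ^ i) / (2.86 * 1.17 ^ (i + 1)) = _
    have hi : (1.17 : ℝ) ^ i ≠ 0 := by positivity
    rw [pow_succ, show (2.86 : ℝ) * (1.17 ^ i * 1.17) = 2.86 * 1.17 ^ i * 1.17 by ring,
      div_mul_cancel_left₀ (by positivity)]
    norm_num [vertexWeight]
  have h2 : startWeight (i + 6) / vertexWeight (i + 6) ≤ startWeight 6 / vertexWeight 6 :=
    div_le_div_of_nonneg_left (startWeight_nonneg 6) (vertexWeight_pos 6)
      (vertexWeight_monotone hk)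
  rw [h1]
  have := h 6 le_rfl
  have := mul_le_mul_of_nonneg_left h2 hβ
  linarith

/-- Among numbers `D a ≤ x exp (τ - κ u a)`, the product weighted by the sum of the `u a` is
bounded, by `y ≤ exp (y - 1)`. -/
theorem sum_mul_prod_le_of_le_exp {ι : Type*} (A : Finset ι) (u D : ι → ℝ) {x τ κ : ℝ}
    (hκ : 0 < κ) (hx : 0 ≤ x) (hD : ∀ a ∈ A, 0 ≤ D a)
    (h : ∀ a ∈ A, D a ≤ x * Real.exp (τ - κ * u a)) (hu : 0 ≤ ∑ a ∈ A, u a) :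
    (∑ a ∈ A, u a) * ∏ a ∈ A, D a ≤ x ^ A.card * Real.exp (A.card * τ - 1) / κ := by
  have h1 : ∏ a ∈ A, D a ≤ x ^ A.card * Real.exp (A.card * τ - κ * ∑ a ∈ A, u a) := by
    refine (Finset.prod_le_prod hD h).trans_eq ?_
    rw [Finset.prod_mul_distrib, Finset.prod_const, ← Real.exp_sum, Finset.sum_sub_distrib,
      Finset.sum_const, nsmul_eq_mul, Finset.mul_sum]
  have h2 : κ * ∑ a ∈ A, u a ≤ Real.exp (κ * ∑ a ∈ A, u a - 1) := by
    have := Real.add_one_le_exp (κ * ∑ a ∈ A, u a - 1)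
    linarith
  rw [le_div_iff₀ hκ]
  calc (∑ a ∈ A, u a) * (∏ a ∈ A, D a) * κ
      ≤ (∑ a ∈ A, u a) * (x ^ A.card * Real.exp (A.card * τ - κ * ∑ a ∈ A, u a)) * κ := by
        gcongr
    _ = x ^ A.card * Real.exp (A.card * τ - κ * ∑ a ∈ A, u a) * (κ * ∑ a ∈ A, u a) := by ring
    _ ≤ x ^ A.card * Real.exp (A.card * τ - κ * ∑ a ∈ A, u a) *
        Real.exp (κ * ∑ a ∈ A, u a - 1) := by gcongr
    _ = x ^ A.card * Real.exp (A.card * τ - 1) := by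
        rw [mul_assoc, ← Real.exp_add]
        congr 2
        ring

/-- Replacing the linear bound of `weight_ratio_le_of_le_six` by a tangent exponential. -/
theorem sum_mul_prod_weight_ratio_le {ι : Type*} (A : Finset ι) (k : ι → ℕ) {x κ : ℝ}
    (hA : A.Nonempty) (hκ : 0 < κ) (hx : 0 ≤ x)
    (h : ∀ k ≤ 6, vertexWeight k / vertexWeight (k + 1) ≤
      x * (1 + 1 / A.card) - x * κ * (startWeight k / vertexWeight k)) :
    (∑ a ∈ A, startWeight (k a) / vertexWeight (k a)) *
      ∏ a ∈ A, vertexWeight (k a) / vertexWeight (k a + 1) ≤ x ^ A.card / κ := by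
  have hcard : (A.card : ℝ) ≠ 0 := by exact_mod_cast hA.card_pos.ne'
  refine (sum_mul_prod_le_of_le_exp A _ _ (τ := 1 / A.card) hκ hx
    (fun a _ => (div_pos (vertexWeight_pos _) (vertexWeight_pos _)).le) (fun a _ => ?_)
    (Finset.sum_nonneg fun a _ =>
      div_nonneg (startWeight_nonneg _) (vertexWeight_pos _).le)).trans_eq ?_
  · refine (weight_ratio_le_of_le_six (by positivity) h (k a)).trans ?_
    have := mul_le_mul_of_nonneg_left (Real.add_one_le_exp
      (1 / (A.card : ℝ) - κ * (startWeight (k a) / vertexWeight (k a)))) hx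
    linarith
  · rw [mul_one_div_cancel hcard, sub_self, Real.exp_zero, mul_one]

theorem sum_mul_prod_weight_ratio_le_startWeight {ι : Type*} (A : Finset ι) (k : ι → ℕ) :
    (∑ a ∈ A, startWeight (k a) / vertexWeight (k a)) *
      ∏ a ∈ A, vertexWeight (k a) / vertexWeight (k a + 1) ≤ startWeight A.card := by
  rcases A.eq_empty_or_nonempty with rfl | hA
  · simp [startWeight]
  obtain ⟨d, hd⟩ : ∃ d, A.card = d := ⟨_, rfl⟩
  match d, hd with
  | 0, hd => exact absurd hd hA.card_pos.ne'
  | 1, hd =>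
    obtain ⟨a, rfl⟩ := Finset.card_eq_one.1 hd
    rw [Finset.sum_singleton, Finset.prod_singleton, hd,
      div_mul_div_cancel₀ (vertexWeight_pos _).ne']
    exact div_le_one_of_le₀ (startWeight_le_vertexWeight_succ _) (vertexWeight_pos _).le
  | 2, hd =>
    refine (sum_mul_prod_weight_ratio_le A k (x := 0.806) (κ := 0.333 / 0.806) hA (by norm_num)
      (by norm_num) ?_).trans ?_
    · intro k hk
      rw [hd]
      interval_cases k <;> norm_num [vertexWeight, startWeight]
    · rw [hd]
      norm_num [startWeight]
  | 3, hd =>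
    refine (sum_mul_prod_weight_ratio_le A k (x := 0.80625) (κ := 0.222 / 0.80625) hA (by norm_num)
      (by norm_num) ?_).trans ?_
    · intro k hk
      rw [hd]
      interval_cases k <;> norm_num [vertexWeight, startWeight]
    · rw [hd]
      norm_num [startWeight]
  | d + 4, hd =>
    refine (sum_mul_prod_le_of_le_exp A _ _ (x := 1) (τ := 0) (κ := 0.16) (by norm_num) zero_le_one
      (fun a _ => (div_pos (vertexWeight_pos _) (vertexWeight_pos _)).le) (fun a _ => ?_)
      (Finset.sum_nonneg fun a _ =>
        div_nonneg (startWeight_nonneg _) (vertexWeight_pos _).le)).trans ?_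
    · refine (weight_ratio_le_of_le_six (α := 1) (β := 0.16) (by norm_num) (fun k hk => ?_)
        (k a)).trans ?_
      · interval_cases k <;> norm_num [vertexWeight, startWeight]
      · have := Real.add_one_le_exp (0 - 0.16 * (startWeight (k a) / vertexWeight (k a)))
        linarith
    · rw [hd, one_pow, one_mul, mul_zero, zero_sub, Real.exp_neg, startWeight]
      have h1 := Real.exp_one_gt_d9
      have h2 : (Real.exp 1)⁻¹ ≤ 2.7182818283⁻¹ := inv_anti₀ (by norm_num) h1.le
      rw [div_le_iff₀ (by norm_num)]
      refine h2.trans (by norm_num)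

/-- The inequality that drives the recursive bound on the number of paths. -/
theorem sum_startWeight_mul_prod_le {ι : Type*} [DecidableEq ι] (A : Finset ι) (k : ι → ℕ)
    (hk : ∀ a ∈ A, 0 < k a) :
    ∑ a ∈ A, startWeight (k a - 1) * ∏ b ∈ A.erase a, vertexWeight (k b - 1) ≤
      startWeight A.card * ∏ a ∈ A, vertexWeight (k a) := by
  have hpos : 0 < ∏ a ∈ A, vertexWeight (k a) := Finset.prod_pos fun a _ => vertexWeight_pos _
  rw [← div_le_iff₀ hpos]
  refine le_trans (le_of_eq ?_) (sum_mul_prod_weight_ratio_le_startWeight A fun a => k a - 1)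
  have hsucc : ∏ a ∈ A, vertexWeight (k a - 1 + 1) = ∏ a ∈ A, vertexWeight (k a) :=
    Finset.prod_congr rfl fun a ha => by rw [Nat.sub_add_cancel (hk a ha)]
  rw [Finset.prod_div_distrib, hsucc, ← mul_div_assoc, Finset.sum_mul]
  congr 1
  refine Finset.sum_congr rfl fun a ha => ?_
  rw [← Finset.mul_prod_erase A _ ha, ← mul_assoc, div_mul_cancel₀ _ (vertexWeight_pos _).ne']

/-! ### Bounds on the numbers of paths and cycles -/

section Bounds

open Classical

variable {V : Type*} [Fintype V]

/-- The number of paths from `s` to `t` is bounded by a product of weights of the degrees. -/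
theorem card_pathSets_le (H : SimpleGraph V) {s t : V} (hst : s ≠ t) :
    ((pathSets H s t).card : ℝ) ≤ startWeight (vdeg H s) * vdeg H t *
      ∏ u ∈ (Finset.univ.erase s).erase t, vertexWeight (vdeg H u) := by
  induction H using WellFoundedLT.induction generalizing s with
  | ind H ih =>
    set H' := H.deleteIncidenceSet s with hH'
    set N := H.neighborFinset s with hN
    set Q := ∏ u ∈ (Finset.univ.erase s).erase t, vertexWeight (vdeg H u) with hQ
    set A := N.erase t with hA
    have hQ1 : 1 ≤ Q := by
      simpa using Finset.prod_le_prod (f := fun _ => (1 : ℝ)) (fun _ _ => zero_le_one)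
        fun u (_ : u ∈ (Finset.univ.erase s).erase t) => one_le_vertexWeight (vdeg H u)
    have hAadj : ∀ a ∈ A, H.Adj s a ∧ a ≠ t := fun a ha =>
      ⟨(H.mem_neighborFinset s a).1 (Finset.mem_of_mem_erase ha), Finset.ne_of_mem_erase ha⟩
    have hcardN : N.card = vdeg H s := by
      rw [vdeg_eq_degree, hN, SimpleGraph.card_neighborFinset_eq_degree]
    have hAsub : A ⊆ (Finset.univ.erase s).erase t := fun a ha =>
      Finset.mem_erase.2 ⟨(hAadj a ha).2, Finset.mem_erase.2 ⟨(hAadj a ha).1.ne.symm,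
        Finset.mem_univ a⟩⟩
    have hsum : (∑ a ∈ A, (pathSets H' a t).card : ℝ) ≤
        startWeight A.card * vdeg H' t * Q := by
      set R := ∏ u ∈ ((Finset.univ.erase s).erase t) \ A, vertexWeight (vdeg H u) with hR
      have hRpos : 0 ≤ R := Finset.prod_nonneg fun u _ => (vertexWeight_pos _).le
      have hQR : Q = R * ∏ u ∈ A, vertexWeight (vdeg H u) := (Finset.prod_sdiff hAsub).symm
      have hterm : ∀ a ∈ A, ((pathSets H' a t).card : ℝ) ≤ vdeg H' t * R *
          (startWeight (vdeg H a - 1) * ∏ b ∈ A.erase a, vertexWeight (vdeg H b - 1)) := by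
        intro a ha
        obtain ⟨hsa, hat⟩ := hAadj a ha
        have hlt : H' < H := by
          refine lt_of_le_of_ne (H.deleteIncidenceSet_le s) fun h => ?_
          have h1 : H'.Adj s a := by rw [h]; exact hsa
          exact (SimpleGraph.deleteIncidenceSet_adj.1 h1).2.1 rfl
        have hset : (Finset.univ.erase a).erase t =
            insert s ((((Finset.univ.erase s).erase t) \ A) ∪ A.erase a) := by
          ext u
          by_cases hus : u = s
          · subst hus
            simp [hst, hsa.ne]
          · by_cases huA : u ∈ A
            · simp [hus, huA, (hAadj u huA).2]
            · have hua : u ≠ a := fun h => huA (h ▸ ha)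
              simp [hus, huA, hua]
        refine (ih H' hlt hat).trans_eq ?_
        rw [hset, Finset.prod_insert (by
            simp only [Finset.mem_union, Finset.mem_sdiff, Finset.mem_erase, not_or]
            exact ⟨fun h => h.1.2.1 rfl, fun h => (hAadj s h.2).1.ne rfl⟩),
          Finset.prod_union (Finset.disjoint_left.2 fun u hu hu' =>
            (Finset.mem_sdiff.1 hu).2 (Finset.mem_of_mem_erase hu')),
          vdeg_deleteIncidenceSet_self, vdeg_deleteIncidenceSet_of_adj hsa]
        have h1 : ∏ u ∈ ((Finset.univ.erase s).erase t) \ A, vertexWeight (vdeg H' u) = R := by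
          refine Finset.prod_congr rfl fun u hu => ?_
          simp only [Finset.mem_sdiff, Finset.mem_erase, hA, hN, SimpleGraph.mem_neighborFinset,
            not_and] at hu
          rw [hH', vdeg_deleteIncidenceSet_of_not_adj hu.1.2.1 (hu.2 hu.1.1)]
        have h2 : ∏ u ∈ A.erase a, vertexWeight (vdeg H' u) =
            ∏ u ∈ A.erase a, vertexWeight (vdeg H u - 1) :=
          Finset.prod_congr rfl fun u hu => by
            rw [hH', vdeg_deleteIncidenceSet_of_adj (hAadj u (Finset.mem_of_mem_erase hu)).1]
        rw [h1, h2, vertexWeight]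
        ring
      refine (Finset.sum_le_sum hterm).trans ?_
      rw [← Finset.mul_sum, hQR]
      have := mul_le_mul_of_nonneg_left (sum_startWeight_mul_prod_le A (vdeg H) fun a ha =>
        vdeg_pos (hAadj a ha).1) (mul_nonneg (Nat.cast_nonneg (vdeg H' t)) hRpos)
      refine this.trans_eq ?_
      ring
    have hcard : ((pathSets H s t).card : ℝ) ≤ ∑ a ∈ N, ((pathSets H' a t).card : ℝ) := by
      have h1 := (Finset.card_le_card (pathSets_subset_biUnion (H := H) hst)).trans
        Finset.card_biUnion_le
      have h2 : ∑ a ∈ N, ((pathSets H' a t).image (insert s(s, a))).card ≤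
          ∑ a ∈ N, (pathSets H' a t).card := Finset.sum_le_sum fun a _ => Finset.card_image_le
      exact_mod_cast h1.trans h2
    refine hcard.trans ?_
    by_cases ht : H.Adj s t
    · have htN : t ∈ N := by simpa [hN] using ht
      have hdt := vdeg_pos ht
      have hds := vdeg_pos ht.symm
      rw [← Finset.add_sum_erase _ _ htN]
      have h1 : ((pathSets H' t t).card : ℝ) ≤ 1 := by exact_mod_cast card_pathSets_self_le H' t
      have h2 : startWeight A.card ≤ startWeight (vdeg H s) :=
        startWeight_monotone (by rw [← hcardN]; exact Finset.card_le_card (N.erase_subset t))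
      have h3 : (vdeg H' t : ℝ) = vdeg H t - 1 := by
        rw [hH', vdeg_deleteIncidenceSet_of_adj ht, Nat.cast_sub hdt, Nat.cast_one]
      have h4 : startWeight A.card * vdeg H' t * Q ≤ startWeight (vdeg H s) * vdeg H' t * Q := by
        gcongr
      have h5 : 1 ≤ startWeight (vdeg H s) * Q :=
        one_le_mul_of_one_le_of_one_le (one_le_startWeight hds) hQ1
      rw [h3] at h4 hsum
      linarith
    · have htN : t ∉ N := by simpa [hN] using ht
      rw [hA, Finset.erase_eq_of_notMem htN, hcardN, hH',
        vdeg_deleteIncidenceSet_of_not_adj hst.symm ht] at hsum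
      exact hsum

/-- Deleting a vertex destroys a number of cycles bounded by a product of weights of degrees. -/
theorem card_cycleSets_le (H : SimpleGraph V) (v : V) :
    ((cycleSets H).card : ℝ) ≤ (cycleSets (H.deleteIncidenceSet v)).card +
      (vdeg H v : ℝ) * (vdeg H v - 1) / 2 * ∏ u ∈ Finset.univ.erase v, vertexWeight (vdeg H u) := by
  obtain ⟨k, hk⟩ : ∃ k, vdeg H v = k := ⟨_, rfl⟩
  rw [hk]
  induction k generalizing H with
  | zero =>
    have hH : H.deleteIncidenceSet v = H := by
      refine le_antisymm (H.deleteIncidenceSet_le v) fun a b hab => ?_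
      rw [SimpleGraph.deleteIncidenceSet_adj]
      refine ⟨hab, ?_, ?_⟩
      · rintro rfl
        exact (vdeg_pos hab.symm).ne' hk
      · rintro rfl
        exact (vdeg_pos hab).ne' hk
    rw [hH]
    simp
  | succ k ih =>
    obtain ⟨a, ha⟩ : (H.neighborSet v).Nonempty :=
      (Set.ncard_pos (Set.toFinite _)).1 (show 0 < vdeg H v by omega)
    have hva : H.Adj v a := ha
    set H' := H.deleteEdges {s(v, a)} with hH'
    have hle : H' ≤ H := H.deleteEdges_le _
    have hk' : vdeg H' v = k := by rw [hH', vdeg_deleteEdges_left hva, hk, Nat.add_sub_cancel]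
    have hdel : H'.deleteIncidenceSet v = H.deleteIncidenceSet v := by
      ext x y
      simp only [SimpleGraph.deleteIncidenceSet_adj, hH', SimpleGraph.deleteEdges_adj,
        Set.mem_singleton_iff, Sym2.eq_iff]
      tauto
    set Q := ∏ u ∈ Finset.univ.erase v, vertexWeight (vdeg H u) with hQ
    have hQ' : ∏ u ∈ Finset.univ.erase v, vertexWeight (vdeg H' u) ≤ Q :=
      Finset.prod_le_prod (fun u _ => (vertexWeight_pos _).le) fun u _ =>
        vertexWeight_monotone (vdeg_mono hle u)
    have h1 := ih H' hk'
    rw [hdel] at h1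
    have hkk : 0 ≤ (k : ℝ) * (k - 1) / 2 := by
      rcases k with _ | k
      · simp
      · push_cast
        rw [add_sub_cancel_right]
        positivity
    have h2 := mul_le_mul_of_nonneg_left hQ' hkk
    have h3 : ((cycleSets H).card : ℝ) ≤ (cycleSets H').card + (pathSets H' a v).card := by
      have := (Finset.card_le_card (cycleSets_subset_union (H := H) (v := v) (a := a))).trans
        (Finset.card_union_le _ _)
      have h' : ((pathSets H' a v).image (insert s(v, a))).card ≤ (pathSets H' a v).card :=
        Finset.card_image_le
      exact_mod_cast this.trans (Nat.add_le_add_left h' _)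
    have h4 : ((pathSets H' a v).card : ℝ) ≤ k * Q := by
      refine (card_pathSets_le H' hva.ne.symm).trans ?_
      have hda : vdeg H' a + 1 = vdeg H a := by
        rw [hH', Sym2.eq_swap, vdeg_deleteEdges_left hva.symm]
        exact Nat.sub_add_cancel (vdeg_pos hva)
      have hQa : Q = vertexWeight (vdeg H a) *
          ∏ u ∈ (Finset.univ.erase a).erase v, vertexWeight (vdeg H u) := by
        rw [hQ, Finset.erase_right_comm]
        exact (Finset.mul_prod_erase _ (fun u => vertexWeight (vdeg H u))
          (Finset.mem_erase.2 ⟨hva.ne.symm, Finset.mem_univ a⟩)).symm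
      have h5 : startWeight (vdeg H' a) ≤ vertexWeight (vdeg H a) := by
        rw [← hda]
        exact startWeight_le_vertexWeight_succ _
      have h6 : ∏ u ∈ (Finset.univ.erase a).erase v, vertexWeight (vdeg H' u) ≤
          ∏ u ∈ (Finset.univ.erase a).erase v, vertexWeight (vdeg H u) :=
        Finset.prod_le_prod (fun u _ => (vertexWeight_pos _).le) fun u _ =>
          vertexWeight_monotone (vdeg_mono hle u)
      have h7 : 0 ≤ ∏ u ∈ (Finset.univ.erase a).erase v, vertexWeight (vdeg H' u) :=
        Finset.prod_nonneg fun u _ => (vertexWeight_pos _).le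
      have h8 := mul_le_mul h5 h6 h7 (vertexWeight_pos _).le
      rw [← hQa] at h8
      have h9 := mul_le_mul_of_nonneg_left h8 (Nat.cast_nonneg (α := ℝ) k)
      rw [hk']
      linarith
    push_cast
    linarith

/-- If every subgraph of `H` has at most `3 n - 6` edges, where `n ≥ 3` is the number of its
vertices, and all edges of `H` lie inside `S`, then `H` has at most `2.86 ^ |S|` cycles. -/
theorem card_cycleSets_le_pow (S : Finset V) (H : SimpleGraph V)
    (hmem : ∀ a b, H.Adj a b → a ∈ S)
    (hsparse : ∀ H' ≤ H, ∀ T : Finset V, (∀ a b, H'.Adj a b → a ∈ T) → 3 ≤ T.card →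
      H'.edgeFinset.card + 6 ≤ 3 * T.card) :
    ((cycleSets H).card : ℝ) ≤ 2.86 ^ S.card := by
  obtain ⟨n, hn⟩ : ∃ n, S.card = n := ⟨_, rfl⟩
  rw [hn]
  induction n generalizing S H with
  | zero =>
    rw [Finset.card_eq_zero] at hn
    have : cycleSets H = ∅ := by
      rw [Finset.eq_empty_iff_forall_notMem]
      intro F hF
      obtain ⟨x, w, hw, -⟩ := mem_cycleSets.1 hF
      have := hmem _ _ (w.adj_snd hw.not_nil)
      simp [hn] at this
    simp [this]
  | succ n ih =>
    have hdelete : ∀ v ∈ S, ((cycleSets (H.deleteIncidenceSet v)).card : ℝ) ≤ 2.86 ^ n := by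
      intro v hv
      refine ih (S.erase v) _ (fun a b hab => ?_) (fun H' hH' => ?_) ?_
      · rw [SimpleGraph.deleteIncidenceSet_adj] at hab
        exact Finset.mem_erase.2 ⟨hab.2.1, hmem a b hab.1⟩
      · exact hsparse H' (hH'.trans (H.deleteIncidenceSet_le v))
      · rw [Finset.card_erase_of_mem hv, hn, Nat.add_sub_cancel]
    rcases Nat.lt_or_ge n 2 with hn2 | hn2
    · obtain ⟨v, hv⟩ : S.Nonempty := Finset.card_pos.1 (by omega)
      have hdeg : vdeg H v ≤ 1 := by
        have hsub : H.neighborSet v ⊆ (S.erase v : Finset V) := fun x hx =>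
          Finset.mem_coe.2 (Finset.mem_erase.2
            ⟨(show H.Adj v x from hx).ne.symm, hmem x v (show H.Adj v x from hx).symm⟩)
        have := Set.ncard_le_ncard hsub
        rw [Set.ncard_coe_finset, Finset.card_erase_of_mem hv] at this
        exact this.trans (by omega)
      have h1 := card_cycleSets_le H v
      have h0 : (vdeg H v : ℝ) * (vdeg H v - 1) / 2 = 0 := by
        interval_cases vdeg H v <;> simp
      rw [h0, zero_mul, add_zero] at h1
      refine (h1.trans (hdelete v hv)).trans ?_
      exact pow_le_pow_right₀ (by norm_num) (Nat.le_succ n)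
    · have hedges := hsparse H le_rfl S hmem (by omega)
      obtain ⟨v, hv, hv5⟩ := exists_degree_le_five (H := H) (S := S) (by omega)
      rw [← vdeg_eq_degree] at hv5
      have hout : ∀ u, u ∉ S → vdeg H u = 0 := by
        intro u hu
        by_contra h
        obtain ⟨x, hx⟩ := (Set.ncard_pos (Set.toFinite _)).1 (Nat.pos_of_ne_zero h)
        exact hu (hmem u x hx)
      have hsumdeg : ∑ u ∈ S, vdeg H u + 12 ≤ 6 * S.card := by
        have h1 : ∑ u ∈ S, vdeg H u ≤ ∑ u, H.degree u := by
          simp only [vdeg_eq_degree]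
          exact Finset.sum_le_sum_of_subset (Finset.subset_univ S)
        rw [SimpleGraph.sum_degrees_eq_twice_card_edges] at h1
        omega
      have hprod : (∏ u ∈ S, vertexWeight (vdeg H u)) * 1.17 ^ 12 ≤ 2.86 ^ S.card := by
        have h1 : ∏ u ∈ S, vertexWeight (vdeg H u) * 1.17 ^ 6 ≤
            ∏ u ∈ S, 2.86 * (1.17 : ℝ) ^ vdeg H u :=
          Finset.prod_le_prod (fun u _ => mul_nonneg (vertexWeight_pos _).le (by norm_num))
            fun u _ => vertexWeight_mul_le _
        rw [Finset.prod_mul_distrib, Finset.prod_mul_distrib, Finset.prod_const, Finset.prod_const,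
          Finset.prod_pow_eq_pow_sum, ← pow_mul] at h1
        obtain ⟨m, hm⟩ := Nat.exists_eq_add_of_le hsumdeg
        rw [hm] at h1
        have h2 : (0 : ℝ) < 1.17 ^ (∑ u ∈ S, vdeg H u) := by positivity
        have h3 : (1 : ℝ) ≤ 1.17 ^ m := one_le_pow₀ (by norm_num)
        have h4 : 0 ≤ ∏ u ∈ S, vertexWeight (vdeg H u) :=
          Finset.prod_nonneg fun u _ => (vertexWeight_pos _).le
        refine le_of_mul_le_mul_right (le_trans ?_ h1) h2
        rw [pow_add, pow_add]
        have h5 := mul_le_mul_of_nonneg_left h3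
          (show 0 ≤ (∏ u ∈ S, vertexWeight (vdeg H u)) * 1.17 ^ 12 * 1.17 ^ (∑ u ∈ S, vdeg H u) by
            positivity)
        linarith
      have herase : ∏ u ∈ Finset.univ.erase v, vertexWeight (vdeg H u) =
          ∏ u ∈ S.erase v, vertexWeight (vdeg H u) := by
        refine (Finset.prod_subset (Finset.erase_subset_erase v (Finset.subset_univ S))
          fun u hu hu' => ?_).symm
        rw [hout u fun h => hu' (Finset.mem_erase.2 ⟨Finset.ne_of_mem_erase hu, h⟩), vertexWeight]
      have h1 := card_cycleSets_le H v
      rw [herase] at h1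
      have h2 : 0 ≤ ∏ u ∈ S.erase v, vertexWeight (vdeg H u) :=
        Finset.prod_nonneg fun u _ => (vertexWeight_pos _).le
      have h3 := mul_le_mul_of_nonneg_right (choose_two_le_vertexWeight hv5) h2
      rw [mul_assoc, Finset.mul_prod_erase S (fun u => vertexWeight (vdeg H u)) hv] at h3
      have h4 := hdelete v hv
      rw [hn, pow_succ] at hprod
      rw [pow_succ]
      have h5 : (0 : ℝ) < 2.86 ^ n := by positivity
      have h6 : ∏ u ∈ S, vertexWeight (vdeg H u) ≤ 2.86 ^ n * 2.86 / 1.17 ^ 12 := by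
        rwa [le_div_iff₀ (by positivity)]
      have h7 : (10 / 2.42 : ℝ) * (2.86 ^ n * 2.86 / 1.17 ^ 12) ≤ 1.86 * 2.86 ^ n := by
        rw [show (10 / 2.42 : ℝ) * (2.86 ^ n * 2.86 / 1.17 ^ 12) =
          (10 / 2.42 * 2.86 / 1.17 ^ 12) * 2.86 ^ n by ring]
        gcongr
        norm_num
      linarith

end Bounds

/-- No planar graph on `n` vertices has more than `2 ^ (1.53 n)` simple cycles
(a simple cycle being identified with its set of edges). -/
theorem stmt4 {V : Type*} [Fintype V] [DecidableEq V] (G : SimpleGraph V) (n : ℕ)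
    (hn : Fintype.card V = n) (hpl : G.IsPlanar) :
    (Nat.card {s : Finset (Sym2 V) //
        ∃ (v : V) (w : G.Walk v v), w.IsCycle ∧ w.edges.toFinset = s} : ℝ)
      ≤ 2 ^ ((1.53 : ℝ) * n) := by
  obtain ⟨M⟩ := hpl.nonempty_planeModel
  have hbound := card_cycleSets_le_pow Finset.univ G (fun a _ _ => Finset.mem_univ a)
    fun H' hle T hT h3 => (M.mono (Finset.subset_univ T) hle hT).card_edgeFinset_add_six_le h3
  rw [Finset.card_univ, hn] at hbound
  have hcard : Nat.card {s : Finset (Sym2 V) //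
      ∃ (v : V) (w : G.Walk v v), w.IsCycle ∧ w.edges.toFinset = s} = (cycleSets G).card := by
    refine Nat.subtype_card _ fun F => ?_
    rw [mem_cycleSets]
    refine exists_congr fun v => exists_congr fun w => and_congr_right fun _ => ?_
    convert Iff.rfl
  have hbase : (2.86 : ℝ) ≤ 2 ^ (1.53 : ℝ) := by
    refine le_of_pow_le_pow_left₀ (n := 100) (by norm_num) (by positivity) ?_
    rw [← Real.rpow_natCast ((2 : ℝ) ^ (1.53 : ℝ)), ← Real.rpow_mul two_pos.le,
      show (1.53 : ℝ) * ((100 : ℕ) : ℝ) = ((153 : ℕ) : ℝ) by norm_num, Real.rpow_natCast]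
    norm_num
  rw [hcard, Real.rpow_mul two_pos.le, Real.rpow_natCast]
  exact hbound.trans (pow_le_pow_left₀ (by norm_num) hbase n)

end
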